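/- arXiv:math/0003098 — 3 statements merged into one kernel-verified Lean document; each statement's English description precedes it below -/
import Mathlib

section
/- Let Λ be a finite subset of ℤ² and call two sites i, j ∈ Λ neighbors if |i − j| = 1. For a real number α and binary images X, Y : Λ → {0,1}, let L_α(X|Y) = α·#{i ∈ Λ : X_i = Y_i} + #{unordered neighbor pairs {i,j} in Λ : X_i = X_j}. Suppose 0 ≤ s ≤ t and the binary image X̂ maximizes L_s(·|Y) over all binary images on Λ, i.e. L_s(Z|Y) ≤ L_s(X̂|Y) for every binary image Z. Then X̂ also maximizes L_t(·|X̂): for every binary image Z on Λ, L_t(Z|X̂) ≤ L_t(X̂|X̂). (In words: the MAP reconstruction map is a fixed point of itself, even when the parameter is increased.) -/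
/-- Two sites of `ℤ²` are neighbors when `|i - j| = 1`. -/
abbrev Nbr (i j : ℤ × ℤ) : Prop :=
  (i.1 - j.1).natAbs + (i.2 - j.2).natAbs = 1

/-- A fixed linear (lexicographic) order on `ℤ²`, used to count each unordered
pair exactly once. -/
abbrev OrdLt (i j : ℤ × ℤ) : Prop :=
  i.1 < j.1 ∨ (i.1 = j.1 ∧ i.2 < j.2)

/-- The number of unordered neighbor pairs `{i, j} ⊆ Λ` satisfying `Q i j`
(`Q` is required to be symmetric in applications, so counting ordered pairs
with `i` lexicographically below `j` counts each unordered pair once). -/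
def nbrPairCount (Λ : Finset (ℤ × ℤ)) (Q : (ℤ × ℤ) → (ℤ × ℤ) → Prop)
    [DecidableRel Q] : ℕ :=
  ((Λ ×ˢ Λ).filter (fun p => OrdLt p.1 p.2 ∧ Nbr p.1 p.2 ∧ Q p.1 p.2)).card

/-- `L_α(X | Y) = α · #{i ∈ Λ : X i = Y i} + #{unordered neighbor pairs {i,j} ⊆ Λ : X i = X j}`. -/
noncomputable def Lfun (Λ : Finset (ℤ × ℤ)) (α : ℝ) (X Y : (ℤ × ℤ) → Bool) : ℝ :=
  α * (Λ.filter (fun i => X i = Y i)).card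
    + nbrPairCount Λ (fun i j => X i = X j)

/-- Triangle inequality for the Hamming distance on `Λ`, in terms of agreement counts. -/
theorem card_agree_add_card_agree_le {ι β : Type*} [DecidableEq ι] [DecidableEq β]
    (Λ : Finset ι) (X Y Z : ι → β) :
    (Λ.filter (fun i => X i = Y i)).card + (Λ.filter (fun i => Z i = X i)).card
      ≤ (Λ.filter (fun i => Z i = Y i)).card + Λ.card := by
  rw [← Finset.card_inter_add_card_union]
  refine Nat.add_le_add (Finset.card_le_card fun i hi => ?_)
    (Finset.card_le_card (Finset.union_subset (Finset.filter_subset _ _)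
      (Finset.filter_subset _ _)))
  simp only [Finset.mem_inter, Finset.mem_filter] at hi ⊢
  exact ⟨hi.1.1, hi.2.2.trans hi.1.2⟩

/-- If `X̂` maximizes `L_s(· | Y)` over all binary images on `Λ`, and `0 ≤ s ≤ t`,
then `X̂` also maximizes `L_t(· | X̂)`: the MAP reconstruction map has each
reconstructed image as a fixed point, even when the parameter is increased. -/
theorem map_reconstruction_fixed_point (Λ : Finset (ℤ × ℤ)) (s t : ℝ)
    (hs : 0 ≤ s) (hst : s ≤ t) (Y Xhat : (ℤ × ℤ) → Bool)
    (hmax : ∀ Z : (ℤ × ℤ) → Bool, Lfun Λ s Z Y ≤ Lfun Λ s Xhat Y) :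
    ∀ Z : (ℤ × ℤ) → Bool, Lfun Λ t Z Xhat ≤ Lfun Λ t Xhat Xhat := by
  intro Z
  have hZ := hmax Z
  have htri : ((Λ.filter (fun i => Xhat i = Y i)).card : ℝ)
      + (Λ.filter (fun i => Z i = Xhat i)).card
      ≤ (Λ.filter (fun i => Z i = Y i)).card + Λ.card := by
    exact_mod_cast card_agree_add_card_agree_le Λ Xhat Y Z
  have hle : ((Λ.filter (fun i => Z i = Xhat i)).card : ℝ) ≤ Λ.card := by
    exact_mod_cast Finset.card_filter_le _ _
  have hself : Λ.filter (fun i => Xhat i = Xhat i) = Λ :=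
    Finset.filter_true_of_mem fun _ _ => rfl
  unfold Lfun at hZ ⊢
  rw [hself]
  have hmul_s := mul_le_mul_of_nonneg_left htri hs
  have hmul_t := mul_nonneg (sub_nonneg.2 hst) (sub_nonneg.2 hle)
  linarith
end

section
/- Let Λ be a finite subset of ℤ², with sites i, j ∈ Λ neighbors when |i − j| = 1, and let α ≥ 0 and Y : Λ → {0,1}. In the network N_α(Y) on the vertex set Λ ∪ {s,t}, the capacity of the cut determined by a binary image X : Λ → {0,1} equals C_{Y,α}(X) = α·#{i ∈ Λ : X_i ≠ Y_i} + #{unordered neighbor pairs {i,j} in Λ : X_i ≠ X_j}. -/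
/-- The vertex set of the network: the sites of `ℤ²` (`Sum.inl i`) together with
a source `Sum.inr false` and a sink `Sum.inr true`. -/
abbrev V : Type := (ℤ × ℤ) ⊕ Bool

/-- The source `s`. -/
def src : V := Sum.inr false

/-- The sink `t`. -/
def snk : V := Sum.inr true

/-- Arc capacities of the network `N_α(Y)`: `c(s,i) = α` if `Y i = 1` (else `0`),
`c(i,t) = α` if `Y i = 0` (else `0`), `c(i,j) = 1` for each ordered pair of
neighbor sites of `Λ`, and all other arcs have capacity `0`. -/
noncomputable def cap (Λ : Finset (ℤ × ℤ)) (Y : (ℤ × ℤ) → Bool) (α : ℝ) :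
    V → V → ℝ
  | Sum.inr false, Sum.inl i => if i ∈ Λ ∧ Y i = true then α else 0
  | Sum.inl i, Sum.inr true => if i ∈ Λ ∧ Y i = false then α else 0
  | Sum.inl i, Sum.inl j => if i ∈ Λ ∧ j ∈ Λ ∧ Nbr i j then (1 : ℝ) else 0
  | _, _ => 0

/-- The arcs of the network: `(s,i)` and `(i,t)` for sites `i ∈ Λ`, and `(i,j)`
for ordered pairs of neighbor sites of `Λ`. -/
def isArc (Λ : Finset (ℤ × ℤ)) : V → V → Bool
  | Sum.inr false, Sum.inl i => decide (i ∈ Λ)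
  | Sum.inl i, Sum.inr true => decide (i ∈ Λ)
  | Sum.inl i, Sum.inl j => decide (i ∈ Λ ∧ j ∈ Λ ∧ Nbr i j)
  | _, _ => false

/-- Embedding of the sites into the vertex set. -/
def siteEmb : (ℤ × ℤ) ↪ V := ⟨Sum.inl, Sum.inl_injective⟩

/-- `A(X) = {s} ∪ {i ∈ Λ : X i = 1}`. -/
def Aset (Λ : Finset (ℤ × ℤ)) (X : (ℤ × ℤ) → Bool) : Finset V :=
  insert (Sum.inr false) ((Λ.filter (fun i => X i = true)).map siteEmb)

/-- `B(X) = {t} ∪ {i ∈ Λ : X i = 0}`. -/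
def Bset (Λ : Finset (ℤ × ℤ)) (X : (ℤ × ℤ) → Bool) : Finset V :=
  insert (Sum.inr true) ((Λ.filter (fun i => X i = false)).map siteEmb)

/-- The cut `𝒞(X)` determined by the binary image `X`: all arcs `(u,v)` of the
network with `u ∈ A(X)` and `v ∈ B(X)`. -/
def cutF (Λ : Finset (ℤ × ℤ)) (X : (ℤ × ℤ) → Bool) : Finset (V × V) :=
  (Aset Λ X ×ˢ Bset Λ X).filter (fun p => isArc Λ p.1 p.2 = true)

/-- The capacity `C_{Y,α}(X)` of the cut `𝒞(X)` in the network `N_α(Y)`. -/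
noncomputable def cutCap (Λ : Finset (ℤ × ℤ)) (Y : (ℤ × ℤ) → Bool) (α : ℝ)
    (X : (ℤ × ℤ) → Bool) : ℝ :=
  ∑ p ∈ cutF Λ X, cap Λ Y α p.1 p.2

/-- `D_{Y,α}(E) = Σ_{e ∈ E} c_{Y,α}(e)` for a set of arcs `E`. -/
noncomputable def Dsum (Λ : Finset (ℤ × ℤ)) (Y : (ℤ × ℤ) → Bool) (α : ℝ)
    (E : Finset (V × V)) : ℝ :=
  ∑ p ∈ E, cap Λ Y α p.1 p.2

theorem cap_eq_zero_of_isArc_ne_true (Λ : Finset (ℤ × ℤ)) (Y : (ℤ × ℤ) → Bool) (α : ℝ)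
    (u v : V) (h : isArc Λ u v ≠ true) : cap Λ Y α u v = 0 := by
  rcases u with i | (_ | _) <;> rcases v with j | (_ | _) <;>
    simp_all [isArc, cap]

/-- The capacity of a cut, split into the source arcs, the sink arcs and the arcs between sites. -/
theorem cutCap_eq_sum (Λ : Finset (ℤ × ℤ)) (Y : (ℤ × ℤ) → Bool) (α : ℝ)
    (X : (ℤ × ℤ) → Bool) :
    cutCap Λ Y α X =
      (∑ j ∈ Λ with X j = false, cap Λ Y α (Sum.inr false) (Sum.inl j))
      + ((∑ i ∈ Λ with X i = true, cap Λ Y α (Sum.inl i) (Sum.inr true))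
      + ∑ i ∈ Λ with X i = true, ∑ j ∈ Λ with X j = false,
          cap Λ Y α (Sum.inl i) (Sum.inl j)) := by
  have h : cutCap Λ Y α X = ∑ p ∈ Aset Λ X ×ˢ Bset Λ X, cap Λ Y α p.1 p.2 := by
    refine Finset.sum_filter_of_ne fun p _ hp => ?_
    by_contra hn
    exact hp (cap_eq_zero_of_isArc_ne_true Λ Y α p.1 p.2 hn)
  have hA : Sum.inr false ∉ (Λ.filter (fun i => X i = true)).map siteEmb := by
    simp [siteEmb]
  have hB : Sum.inr true ∉ (Λ.filter (fun i => X i = false)).map siteEmb := by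
    simp [siteEmb]
  have hst : cap Λ Y α (Sum.inr false) (Sum.inr true) = 0 := rfl
  rw [h, Finset.sum_product, Aset, Bset, Finset.sum_insert hA]
  simp only [Finset.sum_insert hB, Finset.sum_map, Finset.sum_add_distrib, hst, zero_add]
  rfl

/-- The terminal arcs of the cut contribute `α` for each site where `X` and `Y` disagree. -/
theorem sum_terminal_cap (Λ : Finset (ℤ × ℤ)) (Y : (ℤ × ℤ) → Bool) (α : ℝ)
    (X : (ℤ × ℤ) → Bool) :
    (∑ j ∈ Λ with X j = false, cap Λ Y α (Sum.inr false) (Sum.inl j))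
      + (∑ i ∈ Λ with X i = true, cap Λ Y α (Sum.inl i) (Sum.inr true))
      = α * (Λ.filter (fun i => X i ≠ Y i)).card := by
  rw [Finset.sum_filter, Finset.sum_filter, ← Finset.sum_add_distrib, mul_comm,
    ← nsmul_eq_mul, ← Finset.sum_const, Finset.sum_filter]
  refine Finset.sum_congr rfl fun i hi => ?_
  cases hX : X i <;> cases hY : Y i <;> simp [cap, hi, hY]

theorem Nbr.symm {i j : ℤ × ℤ} (h : Nbr i j) : Nbr j i := by
  unfold Nbr at *
  omega

theorem Nbr.ordLt_or_ordLt {i j : ℤ × ℤ} (h : Nbr i j) : OrdLt i j ∨ OrdLt j i := by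
  unfold Nbr at h
  unfold OrdLt
  omega

theorem OrdLt.asymm {i j : ℤ × ℤ} (h : OrdLt i j) : ¬ OrdLt j i := by
  unfold OrdLt at *
  omega

/-- Orienting each unordered neighbor pair with distinct values from value `1` to value `0`
identifies these pairs with the arcs of the cut between sites. -/
theorem card_oriented_eq_nbrPairCount (Λ : Finset (ℤ × ℤ)) (X : (ℤ × ℤ) → Bool) :
    ((Λ ×ˢ Λ).filter (fun p => X p.1 = true ∧ X p.2 = false ∧ Nbr p.1 p.2)).card
      = nbrPairCount Λ (fun i j => X i ≠ X j) := by
  unfold nbrPairCount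
  refine Finset.card_bij' (fun p _ => if OrdLt p.1 p.2 then p else p.swap)
    (fun p _ => if X p.1 = true then p else p.swap) ?_ ?_ ?_ ?_
  · rintro ⟨i, j⟩ hp
    simp only [Finset.mem_filter, Finset.mem_product] at hp ⊢
    obtain ⟨⟨hi, hj⟩, hXi, hXj, hn⟩ := hp
    by_cases ho : OrdLt i j
    · rw [if_pos ho]
      exact ⟨⟨hi, hj⟩, ho, hn, by simp [hXi, hXj]⟩
    · rw [if_neg ho]
      exact ⟨⟨hj, hi⟩, hn.ordLt_or_ordLt.resolve_left ho, hn.symm, by simp [hXi, hXj]⟩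
  · rintro ⟨i, j⟩ hp
    simp only [Finset.mem_filter, Finset.mem_product] at hp ⊢
    obtain ⟨⟨hi, hj⟩, -, hn, hX⟩ := hp
    by_cases hXi : X i = true
    · rw [if_pos hXi]
      exact ⟨⟨hi, hj⟩, hXi, by simpa [hXi] using hX, hn⟩
    · rw [if_neg hXi]
      exact ⟨⟨hj, hi⟩, by simpa [hXi] using hX, by simpa using hXi, hn.symm⟩
  · rintro ⟨i, j⟩ hp
    simp only [Finset.mem_filter, Finset.mem_product] at hp ⊢
    obtain ⟨-, hXi, hXj, -⟩ := hp
    by_cases ho : OrdLt i j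
    · simp only [if_pos ho, if_pos hXi]
    · simp only [if_neg ho, Prod.swap_prod_mk, hXj, Bool.false_eq_true, if_false]
  · rintro ⟨i, j⟩ hp
    simp only [Finset.mem_filter, Finset.mem_product] at hp ⊢
    obtain ⟨-, ho, -, -⟩ := hp
    by_cases hXi : X i = true
    · simp only [if_pos hXi, if_pos ho]
    · simp only [if_neg hXi, Prod.swap_prod_mk, if_neg ho.asymm]

theorem sum_site_cap (Λ : Finset (ℤ × ℤ)) (Y : (ℤ × ℤ) → Bool) (α : ℝ)
    (X : (ℤ × ℤ) → Bool) :
    (∑ i ∈ Λ with X i = true, ∑ j ∈ Λ with X j = false, cap Λ Y α (Sum.inl i) (Sum.inl j))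
      = nbrPairCount Λ (fun i j => X i ≠ X j) := by
  rw [← card_oriented_eq_nbrPairCount, Finset.card_filter, Finset.sum_product, Finset.sum_filter]
  push_cast
  refine Finset.sum_congr rfl fun i hi => ?_
  rw [Finset.sum_filter]
  cases hX : X i
  · simp
  · rw [if_pos rfl]
    refine Finset.sum_congr rfl fun j hj => ?_
    cases hXj : X j <;> simp [cap, hi, hj]

/-- The capacity of the cut determined by a binary image `X` equals
`α · #{i ∈ Λ : X i ≠ Y i} + #{unordered neighbor pairs {i,j} ⊆ Λ : X i ≠ X j}`. -/
theorem cut_capacity_formula (Λ : Finset (ℤ × ℤ)) (α : ℝ) (hα : 0 ≤ α)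
    (Y X : (ℤ × ℤ) → Bool) :
    cutCap Λ Y α X
      = α * (Λ.filter (fun i => X i ≠ Y i)).card
        + nbrPairCount Λ (fun i j => X i ≠ X j) := by
  rw [cutCap_eq_sum, ← add_assoc, sum_terminal_cap, sum_site_cap]
end

section
/- Let Λ be a finite subset of ℤ², with sites i, j ∈ Λ neighbors when |i − j| = 1, let α ≥ 0 and Y : Λ → {0,1}. For every binary image X : Λ → {0,1}, L_α(X|Y) + C_{Y,α}(X) = α·|Λ| + P, where P is the total number of unordered neighbor pairs in Λ. In particular L_α(X|Y) = a − C_{Y,α}(X) for a constant a not depending on X. -/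
theorem cap_eq_zero_of_not_isArc (Λ : Finset (ℤ × ℤ)) (Y : (ℤ × ℤ) → Bool) (α : ℝ) (u v : V)
    (h : ¬ isArc Λ u v = true) : cap Λ Y α u v = 0 := by
  rcases u with i | (_ | _) <;> rcases v with j | (_ | _) <;> simp_all [cap, isArc]

theorem cutCap_eq_sum_s2 (Λ : Finset (ℤ × ℤ)) (Y : (ℤ × ℤ) → Bool) (α : ℝ)
    (X : (ℤ × ℤ) → Bool) :
    cutCap Λ Y α X = ∑ u ∈ Aset Λ X, ∑ v ∈ Bset Λ X, cap Λ Y α u v := by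
  rw [cutCap, cutF, ← Finset.sum_product']
  refine Finset.sum_filter_of_ne fun p _ hp => ?_
  by_contra h
  exact hp (cap_eq_zero_of_not_isArc Λ Y α p.1 p.2 h)

theorem sum_Aset (Λ : Finset (ℤ × ℤ)) (X : (ℤ × ℤ) → Bool) (f : V → ℝ) :
    ∑ u ∈ Aset Λ X, f u
      = f (Sum.inr false) + ∑ i ∈ Λ, if X i = true then f (Sum.inl i) else 0 := by
  rw [Aset, Finset.sum_insert (by simp [siteEmb]), Finset.sum_map, Finset.sum_filter]
  rfl

theorem sum_Bset (Λ : Finset (ℤ × ℤ)) (X : (ℤ × ℤ) → Bool) (f : V → ℝ) :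
    ∑ v ∈ Bset Λ X, f v
      = f (Sum.inr true) + ∑ i ∈ Λ, if X i = false then f (Sum.inl i) else 0 := by
  rw [Bset, Finset.sum_insert (by simp [siteEmb]), Finset.sum_map, Finset.sum_filter]
  rfl

/-- The capacity of a cut is `α` times the number of sites where `X` and `Y` differ, plus the
number of ordered neighbor pairs going from value `1` to value `0`. -/
theorem cutCap_eq_mismatch_add_boundary (Λ : Finset (ℤ × ℤ)) (Y : (ℤ × ℤ) → Bool) (α : ℝ)
    (X : (ℤ × ℤ) → Bool) :
    cutCap Λ Y α X = (∑ i ∈ Λ, if X i = Y i then 0 else α)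
      + ∑ i ∈ Λ, ∑ j ∈ Λ, if X i = true ∧ X j = false ∧ Nbr i j then (1 : ℝ) else 0 := by
  have hsrc : cap Λ Y α (Sum.inr false) (Sum.inr true) = 0 := rfl
  rw [cutCap_eq_sum_s2, sum_Aset, sum_Bset, hsrc, zero_add, ← Finset.sum_add_distrib,
    ← Finset.sum_add_distrib]
  refine Finset.sum_congr rfl fun i hi => ?_
  have hsites : (∑ j ∈ Λ, if X j = false then cap Λ Y α (Sum.inl i) (Sum.inl j) else 0)
      = ∑ j ∈ Λ, if X j = false ∧ Nbr i j then (1 : ℝ) else 0 := by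
    refine Finset.sum_congr rfl fun j hj => ?_
    simp only [cap, hi, hj, true_and, ite_and]
  rw [sum_Bset, hsites]
  cases hX : X i <;> cases hY : Y i <;> simp [cap, hi, hY]

theorem ordLt_iff_not_ordLt_of_nbr {i j : ℤ × ℤ} (h : Nbr i j) : OrdLt j i ↔ ¬ OrdLt i j := by
  simp only [Nbr, OrdLt] at *
  omega

theorem nbr_comm (i j : ℤ × ℤ) : Nbr i j ↔ Nbr j i := by
  simp only [Nbr]
  omega

theorem nbrPairCount_eq_sum (Λ : Finset (ℤ × ℤ)) (Q : (ℤ × ℤ) → (ℤ × ℤ) → Prop)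
    [DecidableRel Q] :
    (nbrPairCount Λ Q : ℝ)
      = ∑ i ∈ Λ, ∑ j ∈ Λ, if OrdLt i j ∧ Nbr i j ∧ Q i j then (1 : ℝ) else 0 := by
  rw [nbrPairCount, ← Finset.sum_boole, Finset.sum_product]

/-- Each unordered neighbor pair with different values is counted by exactly one ordered pair
going from value `1` to value `0`. -/
theorem sum_boundary_eq_nbrPairCount_ne (Λ : Finset (ℤ × ℤ)) (X : (ℤ × ℤ) → Bool) :
    (∑ i ∈ Λ, ∑ j ∈ Λ, if X i = true ∧ X j = false ∧ Nbr i j then (1 : ℝ) else 0)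
      = nbrPairCount Λ (fun i j => X i ≠ X j) := by
  have hsplit : (∑ i ∈ Λ, ∑ j ∈ Λ, if X i = true ∧ X j = false ∧ Nbr i j then (1 : ℝ) else 0)
      = (∑ i ∈ Λ, ∑ j ∈ Λ,
          if OrdLt i j ∧ X i = true ∧ X j = false ∧ Nbr i j then (1 : ℝ) else 0)
        + ∑ i ∈ Λ, ∑ j ∈ Λ,
          if OrdLt j i ∧ X i = true ∧ X j = false ∧ Nbr i j then (1 : ℝ) else 0 := by
    simp only [← Finset.sum_add_distrib]
    refine Finset.sum_congr rfl fun i _ => Finset.sum_congr rfl fun j _ => ?_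
    by_cases hN : Nbr i j
    · have hO' := ordLt_iff_not_ordLt_of_nbr hN
      by_cases hO : OrdLt i j <;> simp only [hO', hO, not_true, not_false_eq_true, true_and,
        false_and, if_false, add_zero, zero_add]
    · simp only [hN, and_false, if_false, add_zero]
  rw [hsplit, Finset.sum_comm (s := Λ) (t := Λ)
    (f := fun i j => if OrdLt j i ∧ X i = true ∧ X j = false ∧ Nbr i j then (1 : ℝ) else 0),
    nbrPairCount_eq_sum]
  simp only [← Finset.sum_add_distrib]
  refine Finset.sum_congr rfl fun i _ => Finset.sum_congr rfl fun j _ => ?_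
  simp only [nbr_comm j i]
  cases X i <;> cases X j <;> simp

theorem nbrPairCount_eq_add_ne (Λ : Finset (ℤ × ℤ)) (X : (ℤ × ℤ) → Bool) :
    (nbrPairCount Λ (fun i j => X i = X j) : ℝ) + nbrPairCount Λ (fun i j => X i ≠ X j)
      = nbrPairCount Λ (fun _ _ => True) := by
  simp only [nbrPairCount_eq_sum, ← Finset.sum_add_distrib]
  refine Finset.sum_congr rfl fun i _ => Finset.sum_congr rfl fun j _ => ?_
  by_cases h : X i = X j <;> simp [h]

theorem mul_card_agree_add_sum_mismatch (Λ : Finset (ℤ × ℤ)) (α : ℝ) (X Y : (ℤ × ℤ) → Bool) :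
    α * (Λ.filter (fun i => X i = Y i)).card + (∑ i ∈ Λ, if X i = Y i then 0 else α)
      = α * Λ.card := by
  rw [← Finset.sum_boole, Finset.mul_sum, ← Finset.sum_add_distrib, mul_comm, ← nsmul_eq_mul,
    ← Finset.sum_const]
  refine Finset.sum_congr rfl fun i _ => ?_
  split_ifs <;> simp

/-- For every binary image `X`,
`L_α(X|Y) + C_{Y,α}(X) = α·|Λ| + P` where `P` is the total number of unordered
neighbor pairs in `Λ`; in particular `L_α(X|Y) = a − C_{Y,α}(X)` for a constant
`a` not depending on `X`. -/
theorem L_add_cutCap_eq_const (Λ : Finset (ℤ × ℤ)) (α : ℝ) (hα : 0 ≤ α)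
    (Y X : (ℤ × ℤ) → Bool) :
    Lfun Λ α X Y + cutCap Λ Y α X
      = α * Λ.card + nbrPairCount Λ (fun _ _ => True) := by
  rw [Lfun, cutCap_eq_mismatch_add_boundary, sum_boundary_eq_nbrPairCount_ne,
    ← nbrPairCount_eq_add_ne Λ X, ← mul_card_agree_add_sum_mismatch Λ α X Y]
  ring
end
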